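/- For every κ > 0 the minimizer set M(κ) is nonempty and compact in L¹(μ). Moreover, if κ_n > 0 with κ_n → κ° > 0 and ρ_n ∈ M(κ_n) for each n, then there exist a subsequence (n_j) and an admissible density ρ° ∈ M(κ°) such that ∫|ρ_{n_j} − ρ°| dμ → 0 as j → ∞. -/

import Mathlib

open scoped BigOperators
open Filter Topology Real MeasureTheory

noncomputable section

/-- The normalized Lebesgue measure `μ = (1/2π) dθ` on `[0, 2π)`. -/
def circleμ : Measure ℝ :=
  (ENNReal.ofReal (1 / (2 * π))) • (volume.restrict (Set.Ico (0:ℝ) (2 * π)))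

/-- An admissible density: measurable, a.e. nonnegative, with total mass one and finite
entropy integral `∫ ρ |log ρ| dμ < ∞` (with the convention `0 · log 0 = 0`). -/
def IsAdmissible (ρ : ℝ → ℝ) : Prop :=
  Measurable ρ ∧ (∀ᵐ θ ∂circleμ, 0 ≤ ρ θ) ∧ (∫ θ, ρ θ ∂circleμ) = 1 ∧
    Integrable (fun θ => ρ θ * |Real.log (ρ θ)|) circleμ

/-- The interaction energy `𝓔(ρ,ρ) = ∬ W(θ−φ) ρ(θ) ρ(φ) dμ(θ) dμ(φ)`. -/
def interactionE (W ρ : ℝ → ℝ) : ℝ :=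
  ∫ θ, (∫ φ, W (θ - φ) * ρ θ * ρ φ ∂circleμ) ∂circleμ

/-- The free energy `𝓕(ρ,κ) = ∫ ρ log ρ dμ − (κ/2) 𝓔(ρ,ρ)`. -/
def freeEnergy (W : ℝ → ℝ) (ρ : ℝ → ℝ) (κ : ℝ) : ℝ :=
  (∫ θ, ρ θ * Real.log (ρ θ) ∂circleμ) - κ / 2 * interactionE W ρ

/-- The minimum free energy `m(κ)`. -/
def minFreeEnergy (W : ℝ → ℝ) (κ : ℝ) : ℝ :=
  sInf {v : ℝ | ∃ ρ : ℝ → ℝ, IsAdmissible ρ ∧ v = freeEnergy W ρ κ}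

/-- The set of global minimizers `M(κ)`. -/
def minimizers (W : ℝ → ℝ) (κ : ℝ) : Set (ℝ → ℝ) :=
  {ρ | IsAdmissible ρ ∧ freeEnergy W ρ κ = minFreeEnergy W κ}

open InformationTheory in
/-- pointwise quantitative midpoint convexity of `x log x`. -/
lemma aux_log {x m : ℝ} (hx : 0 ≤ x) (hm : 0 < m) :
    2 * x - 2 * √m * √x ≤ x * Real.log x - x * Real.log m := by
  rcases hx.eq_or_lt with rfl | hx
  · simp
  have hsx := Real.sqrt_pos.2 hx
  have hsm := Real.sqrt_pos.2 hm
  have h := Real.log_le_sub_one_of_pos (div_pos hsm hsx)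
  rw [Real.log_div hsm.ne' hsx.ne', Real.log_sqrt hx.le, Real.log_sqrt hm.le] at h
  have h2 := mul_le_mul_of_nonneg_left h (by positivity : 0 ≤ 2 * x)
  have h3 : x * (√m / √x) = √m * √x := by
    field_simp
    rw [Real.sq_sqrt hx.le]
  nlinarith

lemma aux_mid {a b t : ℝ} (ha : 0 ≤ a) (hb : 0 ≤ b) (ht : 0 < t) :
    t * |a - b| ≤ (a * Real.log a + b * Real.log b
      - 2 * ((a + b) / 2 * Real.log ((a + b) / 2))) + t ^ 2 * (2 * (a + b)) := by
  set m := (a + b) / 2 with hmdef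
  have hm0 : 0 ≤ m := by positivity
  rcases hm0.eq_or_lt with h | hm
  · have h1 : a = 0 := by linarith
    have h2 : b = 0 := by linarith
    simp [h1, h2, hmdef]
  have h1 := aux_log ha hm
  have h2 := aux_log hb hm
  have hsa := Real.sq_sqrt ha
  have hsb := Real.sq_sqrt hb
  have hsm := Real.sq_sqrt hm0
  have key : (√a - √m) ^ 2 + (√b - √m) ^ 2 ≤ a * Real.log a + b * Real.log b
      - 2 * (m * Real.log m) := by
    have : 2 * (m * Real.log m) = a * Real.log m + b * Real.log m := by rw [hmdef]; ring
    nlinarith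
  have gen : ∀ p q : ℝ, 2 * t * |p ^ 2 - q ^ 2| ≤ (p - q) ^ 2 + t ^ 2 * (2 * (p ^ 2 + q ^ 2)) := by
    intro p q
    rcases abs_cases (p ^ 2 - q ^ 2) with ⟨h, _⟩ | ⟨h, _⟩ <;> rw [h]
    · nlinarith [sq_nonneg ((p - q) - t * (p + q)), sq_nonneg (t * (p - q))]
    · nlinarith [sq_nonneg ((p - q) + t * (p + q)), sq_nonneg (t * (p - q))]
  have g1 := gen (√a) (√m)
  have g2 := gen (√b) (√m)
  rw [hsa, hsm] at g1
  rw [hsb, hsm] at g2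
  have e1 : |a - m| = |a - b| / 2 := by
    rw [show a - m = (a - b) / 2 by rw [hmdef]; ring, abs_div]; norm_num
  have e2 : |b - m| = |a - b| / 2 := by
    rw [show b - m = -((a - b) / 2) by rw [hmdef]; ring, abs_neg, abs_div]; norm_num
  rw [e1] at g1
  rw [e2] at g2
  have : t ^ 2 * (2 * (a + m)) + t ^ 2 * (2 * (b + m)) = t ^ 2 * (4 * (a + b)) := by
    rw [hmdef]; ring
  nlinarith [sq_nonneg (√a - √m), sq_nonneg (√b - √m)]

instance : IsProbabilityMeasure circleμ := by
  constructor
  have : (0:ℝ) < 2 * π := by positivity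
  simp only [circleμ, Measure.smul_apply, Measure.restrict_apply_univ, Real.volume_Ico, sub_zero,
    smul_eq_mul]
  rw [← ENNReal.ofReal_mul (by positivity), one_div, inv_mul_cancel₀ this.ne', ENNReal.ofReal_one]

lemma ae_mem_Icc : ∀ᵐ θ ∂circleμ, θ ∈ Set.Icc (0:ℝ) (2 * π) := by
  unfold circleμ
  apply Measure.ae_smul_measure
  filter_upwards [ae_restrict_mem measurableSet_Ico] with x hx
  exact Set.Ico_subset_Icc_self hx

lemma periodic_unif {W : ℝ → ℝ} (hWc : Continuous W) (hWper : Function.Periodic W (2 * π)) :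
    UniformContinuous W := by
  have : Fact (0 < 2 * π) := ⟨by positivity⟩
  have h1 : Continuous (hWper.lift : AddCircle (2 * π) → ℝ) :=
    continuous_coinduced_dom.2 hWc
  have h2 := CompactSpace.uniformContinuous_of_continuous h1
  have h3 : UniformContinuous (fun x : ℝ => (x : AddCircle (2 * π))) := by
    apply LipschitzWith.uniformContinuous (K := 1)
    apply LipschitzWith.of_dist_le_mul
    intro x y
    rw [dist_eq_norm, ← AddCircle.coe_sub, NNReal.coe_one, one_mul, dist_eq_norm]
    exact QuotientAddGroup.norm_mk_le_norm
  exact h2.comp h3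

/-- potential -/
def pot (W f : ℝ → ℝ) (θ : ℝ) : ℝ := ∫ φ, W (θ - φ) * f φ ∂circleμ

lemma IE_eq (W f : ℝ → ℝ) : interactionE W f = ∫ θ, f θ * pot W f θ ∂circleμ := by
  unfold interactionE pot
  congr 1; ext θ
  rw [← integral_const_mul]
  congr 1; ext φ; ring

lemma pot_int {W : ℝ → ℝ} {C : ℝ} (hWc : Continuous W) (hC : ∀ x, |W x| ≤ C)
    {f : ℝ → ℝ} (hf : Integrable f circleμ) (θ : ℝ) :
    Integrable (fun φ => W (θ - φ) * f φ) circleμ :=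
  hf.bdd_mul (c := C) (by fun_prop) (Eventually.of_forall fun x => hC _)

lemma pot_le {W : ℝ → ℝ} {C : ℝ} (hWc : Continuous W) (hC : ∀ x, |W x| ≤ C)
    {f : ℝ → ℝ} (hf : Integrable f circleμ) (θ : ℝ) :
    |pot W f θ| ≤ C * ∫ φ, |f φ| ∂circleμ := by
  unfold pot
  refine (abs_integral_le_integral_abs).trans ?_
  rw [← integral_const_mul]
  refine integral_mono (pot_int hWc hC hf θ).abs (hf.abs.const_mul C) fun x => ?_
  simp only [abs_mul]
  exact mul_le_mul_of_nonneg_right (hC _) (abs_nonneg _)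

lemma pot_diff {W : ℝ → ℝ} {C : ℝ} (hWc : Continuous W) (hC : ∀ x, |W x| ≤ C)
    {f : ℝ → ℝ} (hf : Integrable f circleμ) {θ θ' ε : ℝ}
    (h : ∀ φ, |W (θ - φ) - W (θ' - φ)| ≤ ε) :
    |pot W f θ - pot W f θ'| ≤ ε * ∫ φ, |f φ| ∂circleμ := by
  unfold pot
  rw [← integral_sub (pot_int hWc hC hf θ) (pot_int hWc hC hf θ')]
  refine (abs_integral_le_integral_abs).trans ?_
  rw [← integral_const_mul]
  refine integral_mono ((pot_int hWc hC hf θ).sub (pot_int hWc hC hf θ')).abs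
    (hf.abs.const_mul ε) fun x => ?_
  simp only [← sub_mul, abs_mul]
  exact mul_le_mul_of_nonneg_right (h _) (abs_nonneg _)

lemma pot_cont {W : ℝ → ℝ} {C : ℝ} (hWc : Continuous W) (hC : ∀ x, |W x| ≤ C)
    {f : ℝ → ℝ} (hf : Integrable f circleμ) : Continuous (pot W f) := by
  unfold pot
  refine continuous_of_dominated (bound := fun φ => C * |f φ|) (fun θ => (pot_int hWc hC hf θ).1)
    (fun θ => Eventually.of_forall fun φ => ?_) (hf.abs.const_mul C)
    (Eventually.of_forall fun φ => by fun_prop)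
  rw [Real.norm_eq_abs, abs_mul]
  exact mul_le_mul_of_nonneg_right (hC _) (abs_nonneg _)

lemma mulpot_int {W : ℝ → ℝ} {C : ℝ} (hWc : Continuous W) (hC : ∀ x, |W x| ≤ C)
    {f g : ℝ → ℝ} (hf : Integrable f circleμ) (hg : Integrable g circleμ) :
    Integrable (fun θ => f θ * pot W g θ) circleμ :=
  hf.mul_bdd (c := C * ∫ φ, |g φ| ∂circleμ) (pot_cont hWc hC hg).aestronglyMeasurable
    (Eventually.of_forall fun x => pot_le hWc hC hg x)

lemma pot_sub {W : ℝ → ℝ} {C : ℝ} (hWc : Continuous W) (hC : ∀ x, |W x| ≤ C)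
    {f g : ℝ → ℝ} (hf : Integrable f circleμ) (hg : Integrable g circleμ) (θ : ℝ) :
    pot W (fun x => f x - g x) θ = pot W f θ - pot W g θ := by
  unfold pot
  rw [← integral_sub (pot_int hWc hC hf θ) (pot_int hWc hC hg θ)]
  congr 1; ext; ring

lemma pot_mid {W : ℝ → ℝ} {C : ℝ} (hWc : Continuous W) (hC : ∀ x, |W x| ≤ C)
    {f g : ℝ → ℝ} (hf : Integrable f circleμ) (hg : Integrable g circleμ) (θ : ℝ) :
    pot W (fun x => (f x + g x) / 2) θ = (pot W f θ + pot W g θ) / 2 := by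
  unfold pot
  rw [← integral_add (pot_int hWc hC hf θ) (pot_int hWc hC hg θ), ← integral_div]
  congr 1; ext; ring

lemma IE_mid {W : ℝ → ℝ} {C : ℝ} (hWc : Continuous W) (hC : ∀ x, |W x| ≤ C)
    {f g : ℝ → ℝ} (hf : Integrable f circleμ) (hg : Integrable g circleμ) :
    interactionE W (fun x => (f x + g x) / 2) = (interactionE W f + interactionE W g) / 2
      - interactionE W (fun x => f x - g x) / 4 := by
  simp only [IE_eq, pot_sub hWc hC hf hg, pot_mid hWc hC hf hg]
  have h1 := mulpot_int hWc hC hf hf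
  have h2 := mulpot_int hWc hC hg hg
  have h3 : Integrable (fun x => (f x - g x) * (pot W f x - pot W g x)) circleμ := by
    refine (mulpot_int hWc hC (hf.sub hg) (hf.sub hg)).congr (Eventually.of_forall fun x => ?_)
    exact congrArg (fun y => (f x - g x) * y) (pot_sub hWc hC hf hg x)
  rw [← integral_add h1 h2, ← integral_div, ← integral_div,
    ← integral_sub (f := fun a => (f a * pot W f a + g a * pot W g a) / 2)
      ((h1.add h2).div_const 2) (h3.div_const 4)]
  congr 1; ext; ring

lemma IE_le_of_pot {W : ℝ → ℝ} {C : ℝ} (hWc : Continuous W) (hC : ∀ x, |W x| ≤ C)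
    {f : ℝ → ℝ} (hf : Integrable f circleμ) {ε : ℝ}
    (h : ∀ θ ∈ Set.Icc (0:ℝ) (2 * π), |pot W f θ| ≤ ε) :
    |interactionE W f| ≤ ε * ∫ φ, |f φ| ∂circleμ := by
  rw [IE_eq]
  refine (abs_integral_le_integral_abs).trans ?_
  rw [← integral_const_mul]
  refine integral_mono_ae (mulpot_int hWc hC hf hf).abs (hf.abs.const_mul ε) ?_
  filter_upwards [ae_mem_Icc] with x hx
  rw [abs_mul, mul_comm]
  exact mul_le_mul_of_nonneg_right (h x hx) (abs_nonneg _)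

lemma IE_sub_le {W : ℝ → ℝ} {C : ℝ} (hWc : Continuous W) (hC : ∀ x, |W x| ≤ C)
    {f g : ℝ → ℝ} (hf : Integrable f circleμ) (hg : Integrable g circleμ)
    (hf1 : ∫ φ, |f φ| ∂circleμ = 1) (hg1 : ∫ φ, |g φ| ∂circleμ = 1) :
    |interactionE W f - interactionE W g| ≤ 2 * C * ∫ φ, |f φ - g φ| ∂circleμ := by
  have hfg := hf.sub hg
  rw [IE_eq, IE_eq, ← integral_sub (mulpot_int hWc hC hf hf) (mulpot_int hWc hC hg hg)]
  set N := ∫ φ, |f φ - g φ| ∂circleμ with hN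
  have hb : ∀ x, |f x * pot W f x - g x * pot W g x| ≤ |f x| * (C * N) + |f x - g x| * C := by
    intro x
    have e : f x * pot W f x - g x * pot W g x
      = f x * pot W (fun x => f x - g x) x + (f x - g x) * pot W g x := by
      rw [pot_sub hWc hC hf hg]; ring
    rw [e]
    refine (abs_add_le _ _).trans ?_
    rw [abs_mul, abs_mul]
    have h1 := pot_le hWc hC hfg x
    have h2 := pot_le hWc hC hg x
    rw [hg1, mul_one] at h2
    gcongr
    exact h1
  refine (abs_integral_le_integral_abs).trans ?_
  have i1 := hf.abs.mul_const (C * N)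
  have i2 := hfg.abs.mul_const C
  refine (integral_mono ((mulpot_int hWc hC hf hf).sub (mulpot_int hWc hC hg hg)).abs
    (i1.add i2) hb).trans ?_
  rw [integral_add' i1 i2, integral_mul_const, integral_mul_const, hf1]
  simp only [Pi.sub_apply, ← hN]
  linarith

section adm
open InformationTheory
variable {ρ : ℝ → ℝ}

theorem IsAdmissible.int (h : IsAdmissible ρ) : Integrable ρ circleμ :=
  integrable_of_integral_eq_one h.2.2.1

theorem IsAdmissible.abs_one (h : IsAdmissible ρ) : ∫ φ, |ρ φ| ∂circleμ = 1 := by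
  rw [← h.2.2.1]
  refine integral_congr_ae ?_
  filter_upwards [h.2.1] with x hx
  exact abs_of_nonneg hx

theorem IsAdmissible.ent (h : IsAdmissible ρ) :
    Integrable (fun θ => ρ θ * Real.log (ρ θ)) circleμ := by
  refine h.2.2.2.mono' ?_ ?_
  · have := h.1; exact (by fun_prop : Measurable _).aestronglyMeasurable
  · filter_upwards [h.2.1] with x hx
    rw [norm_mul, Real.norm_eq_abs, Real.norm_eq_abs, abs_of_nonneg hx]

lemma adm_of_kl (hm : Measurable ρ) (h0 : ∀ᵐ θ ∂circleμ, 0 ≤ ρ θ) (h1 : ∫ θ, ρ θ ∂circleμ = 1)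
    (hk : Integrable (fun θ => klFun (ρ θ)) circleμ) : IsAdmissible ρ := by
  refine ⟨hm, h0, h1, ?_⟩
  have h2 := ((hk.sub (integrable_const 1)).add (integrable_of_integral_eq_one h1)).abs
  refine h2.congr ?_
  filter_upwards [h0] with x hx
  simp only [Pi.add_apply, Pi.sub_apply, klFun_apply]
  rw [show ρ x * Real.log (ρ x) + 1 - ρ x - 1 + ρ x = ρ x * Real.log (ρ x) by ring, abs_mul,
    abs_of_nonneg hx]

theorem IsAdmissible.kl_int (h : IsAdmissible ρ) :
    Integrable (fun θ => klFun (ρ θ)) circleμ :=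
  (h.ent.add (integrable_const 1)).sub h.int

theorem IsAdmissible.kl_eq (h : IsAdmissible ρ) :
    ∫ θ, klFun (ρ θ) ∂circleμ = ∫ θ, ρ θ * Real.log (ρ θ) ∂circleμ := by
  have : ∫ θ, klFun (ρ θ) ∂circleμ = ∫ θ, (ρ θ * Real.log (ρ θ) + 1) - ρ θ ∂circleμ := rfl
  rw [this, integral_sub (f := fun θ => ρ θ * Real.log (ρ θ) + 1) (h.ent.add (integrable_const 1)) h.int,
    integral_add h.ent (integrable_const 1), h.2.2.1]
  simp

theorem IsAdmissible.ent_nonneg (h : IsAdmissible ρ) :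
    0 ≤ ∫ θ, ρ θ * Real.log (ρ θ) ∂circleμ := by
  rw [← h.kl_eq]
  refine integral_nonneg_of_ae ?_
  filter_upwards [h.2.1] with x hx
  exact klFun_nonneg hx

theorem IsAdmissible.mid {σ : ℝ → ℝ} (h : IsAdmissible ρ) (h' : IsAdmissible σ) :
    IsAdmissible (fun x => (ρ x + σ x) / 2) := by
  have hm : Measurable (fun x => (ρ x + σ x) / 2) := (h.1.add h'.1).div_const 2
  refine adm_of_kl hm ?_ ?_ ?_
  · filter_upwards [h.2.1, h'.2.1] with x hx hy
    positivity
  · rw [integral_div, integral_add h.int h'.int, h.2.2.1, h'.2.2.1]; norm_num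
  · refine ((h.kl_int.add h'.kl_int).div_const 2).mono'
      (measurable_klFun.comp hm).aestronglyMeasurable ?_
    filter_upwards [h.2.1, h'.2.1] with x hx hy
    have hz : 0 ≤ (ρ x + σ x) / 2 := by positivity
    rw [Real.norm_eq_abs, abs_of_nonneg (klFun_nonneg hz)]
    have := convexOn_klFun.2 (Set.mem_Ici.2 hx) (Set.mem_Ici.2 hy)
      (by norm_num : (0:ℝ) ≤ 1 / 2) (by norm_num : (0:ℝ) ≤ 1 / 2) (by norm_num)
    simp only [smul_eq_mul] at this
    rw [show 1 / 2 * ρ x + 1 / 2 * σ x = (ρ x + σ x) / 2 by ring] at this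
    simp only [Pi.add_apply]
    linarith

lemma ent_mid {σ : ℝ → ℝ} (h : IsAdmissible ρ) (h' : IsAdmissible σ) {t : ℝ} (ht : 0 < t) :
    t * ∫ x, |ρ x - σ x| ∂circleμ ≤ (∫ x, ρ x * Real.log (ρ x) ∂circleμ)
      + (∫ x, σ x * Real.log (σ x) ∂circleμ)
      - 2 * (∫ x, (ρ x + σ x) / 2 * Real.log ((ρ x + σ x) / 2) ∂circleμ) + 4 * t ^ 2 := by
  have i3 := (h.mid h').ent.const_mul 2
  have i4 := ((h.int.add h'.int).const_mul 2).const_mul (t ^ 2)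
  have i12 := h.ent.add h'.ent
  have := integral_mono_ae ((h.int.sub h'.int).abs.const_mul t) ((i12.sub i3).add i4) (by
    filter_upwards [h.2.1, h'.2.1] with x hx hy
    exact aux_mid hx hy ht)
  rw [integral_add' (i12.sub i3) i4, integral_sub' i12 i3, integral_add' h.ent h'.ent,
    integral_const_mul, integral_const_mul, integral_const_mul, integral_const_mul,
    integral_add' h.int h'.int, h.2.2.1, h'.2.2.1] at this
  simp only [Pi.sub_apply] at this
  linarith

end adm

lemma IE_adm_le {W : ℝ → ℝ} {C : ℝ} (hWc : Continuous W) (hC : ∀ x, |W x| ≤ C) {ρ : ℝ → ℝ}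
    (h : IsAdmissible ρ) : |interactionE W ρ| ≤ C := by
  have := IE_le_of_pot hWc hC h.int (ε := C) (fun θ _ => by
    simpa [h.abs_one] using pot_le hWc hC h.int θ)
  simpa [h.abs_one] using this

lemma bdd {W : ℝ → ℝ} {C : ℝ} (hWc : Continuous W) (hC : ∀ x, |W x| ≤ C) (κ : ℝ) :
    BddBelow {v : ℝ | ∃ ρ : ℝ → ℝ, IsAdmissible ρ ∧ v = freeEnergy W ρ κ} := by
  refine ⟨-(|κ / 2| * C), ?_⟩
  rintro _ ⟨ρ, h, rfl⟩
  unfold freeEnergy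
  have h1 := h.ent_nonneg
  have h2 : |κ / 2 * interactionE W ρ| ≤ |κ / 2| * C := by
    rw [abs_mul]; gcongr; exact IE_adm_le hWc hC h
  linarith [(abs_le.1 h2).2]

lemma min_le {W : ℝ → ℝ} {C : ℝ} (hWc : Continuous W) (hC : ∀ x, |W x| ≤ C) (κ : ℝ)
    {ρ : ℝ → ℝ} (h : IsAdmissible ρ) : minFreeEnergy W κ ≤ freeEnergy W ρ κ :=
  csInf_le (bdd hWc hC κ) ⟨ρ, h, rfl⟩

lemma adm_one : IsAdmissible (fun _ => 1) := by
  refine ⟨measurable_const, by simp, by simp, by simp⟩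

lemma fe_diff {W : ℝ → ℝ} {C : ℝ} (hWc : Continuous W) (hC : ∀ x, |W x| ≤ C) (κ κ' : ℝ)
    {ρ : ℝ → ℝ} (h : IsAdmissible ρ) :
    freeEnergy W ρ κ ≤ freeEnergy W ρ κ' + |κ - κ'| * C := by
  have h2 : |(κ - κ') / 2 * interactionE W ρ| ≤ |κ - κ'| / 2 * C := by
    rw [abs_mul, abs_div, abs_two]; gcongr; exact IE_adm_le hWc hC h
  have h3 : 0 ≤ C := (abs_nonneg _).trans (hC 0)
  have h4 : 0 ≤ |κ - κ'| * C := by positivity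
  unfold freeEnergy
  linarith [(abs_le.1 h2).1]

lemma min_diff {W : ℝ → ℝ} {C : ℝ} (hWc : Continuous W) (hC : ∀ x, |W x| ≤ C) (κ κ' : ℝ) :
    minFreeEnergy W κ ≤ minFreeEnergy W κ' + |κ - κ'| * C := by
  rw [← sub_le_iff_le_add]
  refine le_csInf ⟨_, _, adm_one, rfl⟩ ?_
  rintro _ ⟨ρ, h, rfl⟩
  linarith [min_le hWc hC κ h, fe_diff hWc hC κ κ' h]

/-- Arzelà–Ascoli for the potentials. -/
lemma pot_subseq {W : ℝ → ℝ} {C : ℝ} (hWc : Continuous W) (hWu : UniformContinuous W)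
    (hC : ∀ x, |W x| ≤ C) (ρ : ℕ → ℝ → ℝ) (h : ∀ n, IsAdmissible (ρ n)) :
    ∃ φ : ℕ → ℕ, StrictMono φ ∧ ∀ ε > 0, ∃ N, ∀ m ≥ N, ∀ n ≥ N,
      ∀ θ ∈ Set.Icc (0:ℝ) (2 * π), |pot W (ρ (φ m)) θ - pot W (ρ (φ n)) θ| ≤ ε := by
  let K := Set.Icc (0:ℝ) (2 * π)
  let u : ℕ → BoundedContinuousFunction K ℝ := fun n =>
    BoundedContinuousFunction.mkOfCompact
      ⟨fun x => pot W (ρ n) x, (pot_cont hWc hC (h n).int).comp continuous_subtype_val⟩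
  have hcomp : IsCompact (closure (Set.range u)) := by
    refine BoundedContinuousFunction.arzela_ascoli (Set.Icc (-C) C) isCompact_Icc _ ?_ ?_
    · rintro _ x ⟨n, rfl⟩
      have := pot_le hWc hC (h n).int x
      rw [(h n).abs_one, mul_one] at this
      exact abs_le.1 this
    · apply UniformEquicontinuous.equicontinuous
      rw [Metric.uniformEquicontinuous_iff]
      intro ε hε
      obtain ⟨δ, hδ, hd⟩ := Metric.uniformContinuous_iff.1 hWu (ε / 2) (half_pos hε)
      refine ⟨δ, hδ, ?_⟩
      rintro x y hxy ⟨_, n, rfl⟩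
      have := pot_diff hWc hC (h n).int (θ := x) (θ' := y) (ε := ε / 2) (fun φ => by
        refine (hd (a := x - φ) (b := y - φ) ?_).le
        rw [dist_sub_right]; exact hxy)
      rw [(h n).abs_one, mul_one] at this
      exact this.trans_lt (half_lt_self hε)
  obtain ⟨a, -, φ, hφ, hlim⟩ := hcomp.tendsto_subseq (fun n => subset_closure (Set.mem_range_self n))
  refine ⟨φ, hφ, fun ε hε => ?_⟩
  obtain ⟨N, hN⟩ := Metric.cauchySeq_iff.1 hlim.cauchySeq ε hε
  refine ⟨N, fun m hm n hn θ hθ => ?_⟩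
  exact (BoundedContinuousFunction.dist_coe_le_dist (f := u (φ m)) (g := u (φ n))
    (⟨θ, hθ⟩ : K)).trans (hN m hm n hn).le

lemma min_cauchy {W : ℝ → ℝ} {C : ℝ} (hWc : Continuous W)
    (hC : ∀ x, |W x| ≤ C) {κ : ℝ} (ρ : ℕ → ℝ → ℝ) (h : ∀ n, IsAdmissible (ρ n))
    (hlim : Tendsto (fun n => freeEnergy W (ρ n) κ) atTop (𝓝 (minFreeEnergy W κ)))
    (hpot : ∀ ε > 0, ∃ N, ∀ m ≥ N, ∀ n ≥ N,
      ∀ θ ∈ Set.Icc (0:ℝ) (2 * π), |pot W (ρ m) θ - pot W (ρ n) θ| ≤ ε) :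
    ∀ ε > 0, ∃ N, ∀ m ≥ N, ∀ n ≥ N, ∫ x, |ρ m x - ρ n x| ∂circleμ < ε := by
  intro ε hε
  set t := ε / 8 with ht
  have ht0 : 0 < t := by positivity
  set η := t ^ 2 / (|κ| + 1) with hη
  have hη0 : 0 < η := by positivity
  obtain ⟨N1, hN1⟩ := hpot η hη0
  obtain ⟨N2, hN2⟩ := eventually_atTop.1 (hlim.eventually_lt_const
    (lt_add_of_pos_right (minFreeEnergy W κ) (by positivity : 0 < t ^ 2)))
  refine ⟨max N1 N2, fun m hm n hn => ?_⟩
  have hm1 := (le_max_left _ _).trans hm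
  have hm2 := (le_max_right _ _).trans hm
  have hn1 := (le_max_left _ _).trans hn
  have hn2 := (le_max_right _ _).trans hn
  have f1 := hN2 m hm2
  have f2 := hN2 n hn2
  have hi := (h m).int.sub (h n).int
  have hnorm : ∫ x, |ρ m x - ρ n x| ∂circleμ ≤ 2 := by
    have := integral_mono hi.abs ((h m).int.abs.add (h n).int.abs) (fun x => abs_sub _ _)
    rw [integral_add' (h m).int.abs (h n).int.abs, (h m).abs_one, (h n).abs_one] at this
    simp only [Pi.sub_apply] at this
    linarith
  have hE : |interactionE W (fun x => ρ m x - ρ n x)| ≤ 2 * η := by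
    refine (IE_le_of_pot hWc hC hi (ε := η) (fun θ hθ => ?_)).trans ?_
    · have := pot_sub hWc hC (h m).int (h n).int θ
      exact (congrArg abs this).le.trans (hN1 m hm1 n hn1 θ hθ)
    · simp only [Pi.sub_apply]
      nlinarith
  have hE2 : |κ * interactionE W (fun x => ρ m x - ρ n x)| ≤ 2 * t ^ 2 := by
    rw [abs_mul]
    have : |κ| * η ≤ t ^ 2 := by
      rw [hη, ← mul_div_assoc, div_le_iff₀ (by positivity)]
      nlinarith [sq_nonneg t]
    nlinarith [abs_nonneg κ]
  have hmid := min_le hWc hC κ ((h m).mid (h n))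
  have key := ent_mid (h m) (h n) ht0
  unfold freeEnergy at hmid f1 f2
  rw [IE_mid hWc hC (h m).int (h n).int] at hmid
  have hab := abs_le.1 hE2
  have : t * ∫ x, |ρ m x - ρ n x| ∂circleμ < t * (8 * t) := by nlinarith
  have := lt_of_mul_lt_mul_left this ht0.le
  rw [ht] at this
  linarith

lemma l1_limit (ρ : ℕ → ℝ → ℝ) (h : ∀ n, Integrable (ρ n) circleμ)
    (hc : ∀ ε > 0, ∃ N, ∀ m ≥ N, ∀ n ≥ N, ∫ x, |ρ m x - ρ n x| ∂circleμ < ε) :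
    ∃ g : ℝ → ℝ, Measurable g ∧ Integrable g circleμ ∧
      Tendsto (fun n => ∫ x, |ρ n x - g x| ∂circleμ) atTop (𝓝 0) := by
  let F : ℕ → (ℝ →₁[circleμ] ℝ) := fun n => (h n).toL1 (ρ n)
  have hF : CauchySeq F := by
    rw [Metric.cauchySeq_iff]
    intro ε hε
    obtain ⟨N, hN⟩ := hc ε hε
    refine ⟨N, fun m hm n hn => ?_⟩
    rw [L1.dist_eq_integral_dist]
    refine lt_of_eq_of_lt (integral_congr_ae ?_) (hN m hm n hn)
    filter_upwards [(h m).coeFn_toL1, (h n).coeFn_toL1] with x h1 h2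
    rw [h1, h2, Real.dist_eq]
  obtain ⟨g, hg⟩ := cauchySeq_tendsto_of_complete hF
  refine ⟨g, (Lp.stronglyMeasurable g).measurable, L1.integrable_coeFn g, ?_⟩
  have := tendsto_iff_dist_tendsto_zero.1 hg
  refine this.congr fun n => ?_
  rw [L1.dist_eq_integral_dist]
  refine integral_congr_ae ?_
  filter_upwards [(h n).coeFn_toL1] with x h1
  rw [h1, Real.dist_eq]

open InformationTheory in
lemma limit_min {W : ℝ → ℝ} {C : ℝ} (hWc : Continuous W)
    (hC : ∀ x, |W x| ≤ C) {κ : ℝ} (ρ : ℕ → ℝ → ℝ) (h : ∀ n, IsAdmissible (ρ n))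
    (hlim : Tendsto (fun n => freeEnergy W (ρ n) κ) atTop (𝓝 (minFreeEnergy W κ)))
    {g : ℝ → ℝ} (gm : Measurable g) (gi : Integrable g circleμ)
    (hg : Tendsto (fun n => ∫ x, |ρ n x - g x| ∂circleμ) atTop (𝓝 0)) :
    g ∈ minimizers W κ := by
  have hmeas : TendstoInMeasure circleμ ρ atTop g := by
    refine tendstoInMeasure_of_tendsto_eLpNorm one_ne_zero
      (fun n => (h n).1.aestronglyMeasurable) gm.aestronglyMeasurable ?_
    have := ENNReal.tendsto_ofReal hg
    rw [ENNReal.ofReal_zero] at this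
    refine this.congr fun n => ?_
    rw [eLpNorm_one_eq_lintegral_enorm,
      ← ofReal_integral_norm_eq_lintegral_enorm ((h n).int.sub gi)]
    rfl
  obtain ⟨ns, hns, hae⟩ := hmeas.exists_seq_tendsto_ae
  have g0 : ∀ᵐ x ∂circleμ, 0 ≤ g x := by
    filter_upwards [hae, ae_all_iff.2 (fun n => (h n).2.1)] with x hx h0
    exact ge_of_tendsto' hx fun n => h0 _
  have g1 : ∫ x, g x ∂circleμ = 1 := by
    have := tendsto_integral_of_L1 g gi.1 (Eventually.of_forall fun n => (h n).int) (l := atTop) (by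
      have := ENNReal.tendsto_ofReal hg
      rw [ENNReal.ofReal_zero] at this
      refine this.congr fun n => ?_
      exact ofReal_integral_norm_eq_lintegral_enorm ((h n).int.sub gi))
    simp only [(h _).2.2.1] at this
    exact (tendsto_nhds_unique tendsto_const_nhds this).symm
  have gabs : ∫ φ, |g φ| ∂circleμ = 1 := by
    rw [← g1]
    refine integral_congr_ae ?_
    filter_upwards [g0] with x hx
    exact abs_of_nonneg hx
  have hE : Tendsto (fun n => interactionE W (ρ n)) atTop (𝓝 (interactionE W g)) := by
    rw [tendsto_iff_dist_tendsto_zero]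
    refine squeeze_zero (fun _ => dist_nonneg)
      (fun n => IE_sub_le hWc hC (h n).int gi (h n).abs_one gabs) ?_
    simpa using hg.const_mul (2 * C)
  set L := minFreeEnergy W κ + κ / 2 * interactionE W g with hL
  have hH : Tendsto (fun n => ∫ x, klFun (ρ n x) ∂circleμ) atTop (𝓝 L) := by
    refine (hlim.add (hE.const_mul (κ / 2))).congr fun n => ?_
    rw [(h n).kl_eq]; unfold freeEnergy; ring
  have hfat : ∫⁻ x, ENNReal.ofReal (klFun (g x)) ∂circleμ ≤ ENNReal.ofReal L := by
    have e1 : ∫⁻ x, ENNReal.ofReal (klFun (g x)) ∂circleμ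
        = ∫⁻ x, liminf (fun i => ENNReal.ofReal (klFun (ρ (ns i) x))) atTop ∂circleμ := by
      refine lintegral_congr_ae ?_
      filter_upwards [hae] with x hx
      exact ((ENNReal.tendsto_ofReal
        ((continuous_klFun.tendsto _).comp hx)).liminf_eq).symm
    rw [e1]
    refine (lintegral_liminf_le fun i =>
      (measurable_klFun.comp (h (ns i)).1).ennreal_ofReal).trans ?_
    refine le_of_eq (Tendsto.liminf_eq ?_)
    refine (ENNReal.tendsto_ofReal (hH.comp hns.tendsto_atTop)).congr fun n => ?_
    refine ofReal_integral_eq_lintegral_ofReal (h (ns n)).kl_int ?_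
    filter_upwards [(h (ns n)).2.1] with x hx
    exact klFun_nonneg hx
  have gk0 : 0 ≤ᵐ[circleμ] fun x => klFun (g x) := by
    filter_upwards [g0] with x hx
    exact klFun_nonneg hx
  have gkm : Measurable (fun x => klFun (g x)) := measurable_klFun.comp gm
  have gk : Integrable (fun x => klFun (g x)) circleμ := by
    refine ⟨gkm.aestronglyMeasurable, ?_⟩
    rw [hasFiniteIntegral_iff_ofReal gk0]
    exact hfat.trans_lt ENNReal.ofReal_lt_top
  have gadm := adm_of_kl gm g0 g1 gk
  refine ⟨gadm, le_antisymm ?_ (min_le hWc hC κ gadm)⟩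
  have hL0 : 0 ≤ L := ge_of_tendsto' hH fun n => by
    rw [(h n).kl_eq]; exact (h n).ent_nonneg
  rw [← ofReal_integral_eq_lintegral_ofReal gk gk0, ENNReal.ofReal_le_ofReal_iff hL0,
    gadm.kl_eq] at hfat
  unfold freeEnergy
  linarith

lemma main_seq {W : ℝ → ℝ} {C : ℝ} (hWc : Continuous W) (hWu : UniformContinuous W)
    (hC : ∀ x, |W x| ≤ C) {κ : ℝ} (ρ : ℕ → ℝ → ℝ) (h : ∀ n, IsAdmissible (ρ n))
    (hlim : Tendsto (fun n => freeEnergy W (ρ n) κ) atTop (𝓝 (minFreeEnergy W κ))) :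
    ∃ φ : ℕ → ℕ, StrictMono φ ∧ ∃ ρ0 ∈ minimizers W κ,
          Filter.Tendsto (fun j => ∫ θ, |ρ (φ j) θ - ρ0 θ| ∂circleμ)
            Filter.atTop (𝓝 0) := by
  obtain ⟨φ, hφ, hp⟩ := pot_subseq hWc hWu hC ρ h
  have hl := hlim.comp hφ.tendsto_atTop
  have hc := min_cauchy hWc hC (fun n => ρ (φ n)) (fun n => h _) hl hp
  obtain ⟨g, gm, gi, hg⟩ := l1_limit (fun n => ρ (φ n)) (fun n => (h _).int) hc
  exact ⟨φ, hφ, g, limit_min hWc hC _ (fun n => h (φ n)) hl gm gi hg, hg⟩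

/-- for every `κ > 0` the minimizer set `M(κ)` is nonempty and sequentially
compact in `L¹(μ)`; moreover along `κ_n → κ° > 0` with `ρ_n ∈ M(κ_n)` there is a subsequence
converging in `L¹(μ)` to some `ρ° ∈ M(κ°)`. -/
theorem minimizers_nonempty_compact
    (W : ℝ → ℝ) (hWc : Continuous W) (hWe : ∀ θ, W (-θ) = W θ)
    (hWper : Function.Periodic W (2 * π)) :
    (∀ κ : ℝ, 0 < κ →
      (minimizers W κ).Nonempty ∧
      ∀ ρn : ℕ → ℝ → ℝ, (∀ n, ρn n ∈ minimizers W κ) →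
        ∃ φ : ℕ → ℕ, StrictMono φ ∧ ∃ ρ0 ∈ minimizers W κ,
          Filter.Tendsto (fun j => ∫ θ, |ρn (φ j) θ - ρ0 θ| ∂circleμ)
            Filter.atTop (𝓝 0)) ∧
    (∀ κn : ℕ → ℝ, ∀ κ0 : ℝ, (∀ n, 0 < κn n) → 0 < κ0 →
      Filter.Tendsto κn Filter.atTop (𝓝 κ0) →
      ∀ ρn : ℕ → ℝ → ℝ, (∀ n, ρn n ∈ minimizers W (κn n)) →
        ∃ φ : ℕ → ℕ, StrictMono φ ∧ ∃ ρ0 ∈ minimizers W κ0,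
          Filter.Tendsto (fun j => ∫ θ, |ρn (φ j) θ - ρ0 θ| ∂circleμ)
            Filter.atTop (𝓝 0)) := by
  have hWu := periodic_unif hWc hWper
  obtain ⟨C, hC'⟩ := (hWper.isBounded_of_continuous (by positivity) hWc).exists_norm_le
  have hC : ∀ x, |W x| ≤ C := fun x => hC' _ (Set.mem_range_self x)
  have second : ∀ κn : ℕ → ℝ, ∀ κ0 : ℝ, Filter.Tendsto κn Filter.atTop (𝓝 κ0) →
      ∀ ρn : ℕ → ℝ → ℝ, (∀ n, ρn n ∈ minimizers W (κn n)) →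
        ∃ φ : ℕ → ℕ, StrictMono φ ∧ ∃ ρ0 ∈ minimizers W κ0,
          Filter.Tendsto (fun j => ∫ θ, |ρn (φ j) θ - ρ0 θ| ∂circleμ)
            Filter.atTop (𝓝 0) := by
    intro κn κ0 hκ ρn hρ
    refine main_seq hWc hWu hC ρn (fun n => (hρ n).1) ?_
    have hz : Tendsto (fun n => minFreeEnergy W κ0 + 2 * (|κn n - κ0| * C)) atTop
        (𝓝 (minFreeEnergy W κ0)) := by
      have h1 : Tendsto (fun n => |κn n - κ0|) atTop (𝓝 0) := by
        simpa [Real.dist_eq] using tendsto_iff_dist_tendsto_zero.1 hκ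
      simpa using ((h1.mul_const C).const_mul 2).const_add (minFreeEnergy W κ0)
    refine tendsto_of_tendsto_of_tendsto_of_le_of_le tendsto_const_nhds hz
      (fun n => min_le hWc hC κ0 (hρ n).1) (fun n => ?_)
    have h1 := fe_diff hWc hC κ0 (κn n) (hρ n).1
    have h2 := min_diff hWc hC (κn n) κ0
    rw [(hρ n).2, abs_sub_comm] at h1
    show freeEnergy W (ρn n) κ0 ≤ minFreeEnergy W κ0 + 2 * (|κn n - κ0| * C)
    linarith
  refine ⟨fun κ _ => ⟨?_, fun ρn hρ => second (fun _ => κ) κ tendsto_const_nhds ρn hρ⟩,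
    fun κn κ0 _ _ hκ ρn hρ => second κn κ0 hκ ρn hρ⟩
  obtain ⟨u, -, hu, hmem⟩ := exists_seq_tendsto_sInf
    (⟨_, _, adm_one, rfl⟩ : {v : ℝ | ∃ ρ : ℝ → ℝ, IsAdmissible ρ ∧ v = freeEnergy W ρ κ}.Nonempty)
    (bdd hWc hC κ)
  choose ρ hρ hv using hmem
  obtain ⟨_, _, g, hg, _⟩ := main_seq hWc hWu hC ρ hρ (κ := κ) (hu.congr hv)
  exact ⟨g, hg⟩
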